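/- In the orthonormal Lie-algebra frame $\{\mathbf{X},\mathbf{Y},\mathbf{T}\}$ with brackets $[\mathbf{X},\mathbf{Y}]=2(\mathbf{Y}-\mathbf{T})$, $[\mathbf{X},\mathbf{T}]=[\mathbf{Y},\mathbf{T}]=0$, the sectional curvatures of the Levi-Civita connection satisfy $K(\mathbf{X},\mathbf{Y})=-7$, $K(\mathbf{X},\mathbf{T})=1$, $K(\mathbf{Y},\mathbf{T})=1$. -/

import Mathlib

def gmet (u v : Fin 3 → ℝ) : ℝ := u 0 * v 0 + u 1 * v 1 + u 2 * v 2

def lieBr (u v : Fin 3 → ℝ) : Fin 3 → ℝ :=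
  ![0, 2 * (u 0 * v 1 - u 1 * v 0), -2 * (u 0 * v 1 - u 1 * v 0)]

def eX : Fin 3 → ℝ := ![1, 0, 0]
def eY : Fin 3 → ℝ := ![0, 1, 0]
def eT : Fin 3 → ℝ := ![0, 0, 1]

/-- The curvature tensor `R(X,Y)Z = ∇_Y∇_X Z - ∇_X∇_Y Z + ∇_{[X,Y]} Z`. -/
def curv (nab : (Fin 3 → ℝ) → (Fin 3 → ℝ) → (Fin 3 → ℝ))
    (u v w : Fin 3 → ℝ) : Fin 3 → ℝ :=
  nab v (nab u w) - nab u (nab v w) + nab (lieBr u v) w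

/-- Sectional curvatures of the distinguished planes:
`K(X,Y) = -7`, `K(X,T) = 1`, `K(Y,T) = 1`, where `K(U,V) = g(R(U,V)U, V)`. -/
theorem sectional_curvatures
    (nab : (Fin 3 → ℝ) → (Fin 3 → ℝ) → (Fin 3 → ℝ))
    (hK : ∀ u v w : Fin 3 → ℝ,
      -2 * gmet w (nab v u) = gmet (lieBr u w) v + gmet (lieBr v w) u + gmet (lieBr u v) w) :
    gmet (curv nab eX eY eX) eY = -7 ∧
    gmet (curv nab eX eT eX) eT = 1 ∧
    gmet (curv nab eY eT eY) eT = 1 := by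
  have h : ∀ v u : Fin 3 → ℝ, nab v u =
      ![u 1 * (v 1 - v 2) + v 1 * (u 1 - u 2),
        -(u 0 * (v 1 - v 2) + v 0 * (u 1 - u 2) + (u 0 * v 1 - u 1 * v 0)),
        u 0 * v 1 - u 1 * v 0] := by
    intro v u
    have h0 := hK u v eX
    have h1 := hK u v eY
    have h2 := hK u v eT
    simp [gmet, lieBr, eX, eY, eT] at h0 h1 h2
    ext i
    fin_cases i
    · simp; linarith
    · simp; linarith
    · simp; linarith
  refine ⟨?_, ?_, ?_⟩ <;> simp [curv, h, gmet, lieBr, eX, eY, eT] <;> norm_num
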